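/- Let x_1, …, x_n ∈ ℝ^d (n ≥ 1), σ > 0, 0 ≤ δ ≤ 1, and let P̂(x) = (1/n) Σ_{j=1}^n (√π σ)^{−d} exp(−‖x − x_j‖²/σ²) be the Gaussian Parzen estimator. Suppose the Gaussian-kernel dictionary is δ-distant, i.e. 1 − exp(−‖x_i − x_j‖²/(2σ²))² ≥ δ² for all i ≠ j. Then the estimated quadratic Rényi entropy H₂ = −log ∫_{ℝ^d} P̂(x)² dx satisfies H₂ ≥ (d/2) log(2πσ²) + log n − log(1 + (n−1)√(1−δ²)). -/

import Mathlib

open MeasureTheory Real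


lemma aux_prod {d : ℕ} (σ : ℝ) (hσ : 0 < σ) (a b x : EuclideanSpace ℝ (Fin d)) :
    Real.exp (-‖x - a‖ ^ 2 / σ ^ 2) * Real.exp (-‖x - b‖ ^ 2 / σ ^ 2) =
      Real.exp (-(2 / σ ^ 2) * ‖x - (1 / 2 : ℝ) • (a + b)‖ ^ 2) *
        Real.exp (-‖a - b‖ ^ 2 / (2 * σ ^ 2)) := by
  rw [← Real.exp_add, ← Real.exp_add]
  congr 1
  have h := parallelogram_law_with_norm ℝ (x - a) (x - b)
  have h1 : x - a + (x - b) = (2 : ℝ) • (x - (1 / 2 : ℝ) • (a + b)) := by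
    module
  have h2 : x - a - (x - b) = -(a - b) := by abel
  rw [h1, h2, norm_neg, norm_smul] at h
  norm_num at h
  have h3 : 2 * ‖x - (1 / 2 : ℝ) • (a + b)‖ ^ 2 + ‖a - b‖ ^ 2 / 2
      = ‖x - a‖ ^ 2 + ‖x - b‖ ^ 2 := by
    norm_num
    linarith
  have : -‖x - a‖ ^ 2 / σ ^ 2 + -‖x - b‖ ^ 2 / σ ^ 2
      = -(‖x - a‖ ^ 2 + ‖x - b‖ ^ 2) / σ ^ 2 := by ring
  rw [this, ← h3]
  field_simp
  ring

lemma aux_int0 {d : ℕ} (c : ℝ) (hc : 0 < c) :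
    Integrable (fun x : EuclideanSpace ℝ (Fin d) => Real.exp (-c * ‖x‖ ^ 2)) := by
  by_contra h
  have h1 := integral_undef h
  rw [GaussianFourier.integral_rexp_neg_mul_sq_norm hc] at h1
  have : 0 < (π / c) ^ (Module.finrank ℝ (EuclideanSpace ℝ (Fin d)) / 2 : ℝ) := by positivity
  linarith

lemma aux_int {d : ℕ} (σ : ℝ) (hσ : 0 < σ) (a b : EuclideanSpace ℝ (Fin d)) :
    Integrable (fun x : EuclideanSpace ℝ (Fin d) =>
      Real.exp (-‖x - a‖ ^ 2 / σ ^ 2) * Real.exp (-‖x - b‖ ^ 2 / σ ^ 2)) := by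
  simp_rw [aux_prod σ hσ a b]
  exact ((aux_int0 (d := d) (2 / σ ^ 2) (by positivity)).comp_sub_right _).mul_const _

lemma aux_val {d : ℕ} (σ : ℝ) (hσ : 0 < σ) (a b : EuclideanSpace ℝ (Fin d)) :
    ∫ x : EuclideanSpace ℝ (Fin d),
      Real.exp (-‖x - a‖ ^ 2 / σ ^ 2) * Real.exp (-‖x - b‖ ^ 2 / σ ^ 2) =
      (π / (2 / σ ^ 2)) ^ ((d : ℝ) / 2) * Real.exp (-‖a - b‖ ^ 2 / (2 * σ ^ 2)) := by
  simp_rw [aux_prod σ hσ a b]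
  rw [integral_mul_const,
    integral_sub_right_eq_self (fun x : EuclideanSpace ℝ (Fin d) =>
      Real.exp (-(2 / σ ^ 2) * ‖x‖ ^ 2)),
    GaussianFourier.integral_rexp_neg_mul_sq_norm (by positivity)]
  simp

lemma aux_total (d n : ℕ) (X : Fin n → EuclideanSpace ℝ (Fin d)) (σ : ℝ) (hσ : 0 < σ) :
    (∫ x : EuclideanSpace ℝ (Fin d),
        ((1 / (n : ℝ)) * ∑ j, ((Real.sqrt π * σ) ^ d)⁻¹ *
          Real.exp (-‖x - X j‖ ^ 2 / σ ^ 2)) ^ 2) =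
    ((1 / (n : ℝ)) * ((Real.sqrt π * σ) ^ d)⁻¹) ^ 2 * ((π / (2 / σ ^ 2)) ^ ((d : ℝ) / 2) *
      ∑ i, ∑ j, Real.exp (-‖X i - X j‖ ^ 2 / (2 * σ ^ 2))) := by
  have h : ∀ x : EuclideanSpace ℝ (Fin d), ((1 / (n : ℝ)) * ∑ j, ((Real.sqrt π * σ) ^ d)⁻¹ *
          Real.exp (-‖x - X j‖ ^ 2 / σ ^ 2)) ^ 2 =
      ((1 / (n : ℝ)) * ((Real.sqrt π * σ) ^ d)⁻¹) ^ 2 * ∑ i, ∑ j,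
        (Real.exp (-‖x - X i‖ ^ 2 / σ ^ 2) * Real.exp (-‖x - X j‖ ^ 2 / σ ^ 2)) := by
    intro x
    rw [← Finset.mul_sum, ← mul_assoc, mul_pow, sq (∑ j, _), Finset.sum_mul_sum]
  simp_rw [h]
  rw [integral_const_mul, integral_finsetSum]
  · congr 1
    rw [Finset.mul_sum]
    refine Finset.sum_congr rfl fun i _ => ?_
    rw [integral_finsetSum _ (fun j _ => aux_int σ hσ _ _), Finset.mul_sum]
    exact Finset.sum_congr rfl fun j _ => aux_val σ hσ _ _
  · intro i _
    exact integrable_finsetSum _ (fun j _ => aux_int σ hσ _ _)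

/-- For a `δ`-distant Gaussian-kernel dictionary, the estimated quadratic Rényi entropy is
lower-bounded by `(d/2) log(2πσ²) + log n − log(1 + (n−1)√(1−δ²))`. -/
theorem quadratic_entropy_lower_bound_distant (d n : ℕ) (hn : 1 ≤ n)
    (X : Fin n → EuclideanSpace ℝ (Fin d)) (σ δ : ℝ) (hσ : 0 < σ)
    (hδ0 : 0 ≤ δ) (hδ1 : δ ≤ 1)
    (hdist : ∀ i j, i ≠ j →
        δ ^ 2 ≤ 1 - (Real.exp (-‖X i - X j‖ ^ 2 / (2 * σ ^ 2))) ^ 2) :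
    (d : ℝ) / 2 * Real.log (2 * π * σ ^ 2) + Real.log n
        - Real.log (1 + ((n : ℝ) - 1) * Real.sqrt (1 - δ ^ 2)) ≤
      -Real.log (∫ x : EuclideanSpace ℝ (Fin d),
        ((1 / (n : ℝ)) * ∑ j, ((Real.sqrt π * σ) ^ d)⁻¹ *
          Real.exp (-‖x - X j‖ ^ 2 / σ ^ 2)) ^ 2) := by
  have hn0 : (0 : ℝ) < n := by exact_mod_cast hn
  have hn1 : (1 : ℝ) ≤ n := by exact_mod_cast hn
  rw [aux_total d n X σ hσ]
  set S := ∑ i, ∑ j, Real.exp (-‖X i - X j‖ ^ 2 / (2 * σ ^ 2)) with hS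
  set s := Real.sqrt (1 - δ ^ 2) with hs
  have hs0 : 0 ≤ s := Real.sqrt_nonneg _
  have hSle : S ≤ n * (1 + ((n : ℝ) - 1) * s) := by
    have hrow : ∀ i, ∑ j, Real.exp (-‖X i - X j‖ ^ 2 / (2 * σ ^ 2))
        ≤ 1 + ((n : ℝ) - 1) * s := by
      intro i
      rw [← Finset.add_sum_erase _ _ (Finset.mem_univ i)]
      have h1 : ∑ j ∈ Finset.univ.erase i, Real.exp (-‖X i - X j‖ ^ 2 / (2 * σ ^ 2))
          ≤ ∑ j ∈ Finset.univ.erase i, s := by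
        refine Finset.sum_le_sum fun j hj => ?_
        have hij : i ≠ j := (Finset.ne_of_mem_erase hj).symm
        apply Real.le_sqrt_of_sq_le
        linarith [hdist i j hij]
      rw [Finset.sum_const, Finset.card_erase_of_mem (Finset.mem_univ i), Finset.card_univ,
        Fintype.card_fin, nsmul_eq_mul, Nat.cast_sub hn, Nat.cast_one] at h1
      have h0 : Real.exp (-‖X i - X i‖ ^ 2 / (2 * σ ^ 2)) = 1 := by simp
      rw [h0]
      linarith
    calc S ≤ ∑ i : Fin n, (1 + ((n : ℝ) - 1) * s) := Finset.sum_le_sum fun i _ => hrow i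
      _ = _ := by rw [Finset.sum_const, Finset.card_univ, Fintype.card_fin, nsmul_eq_mul]
  have hSpos : 0 < S := by
    have : Nonempty (Fin n) := ⟨⟨0, hn⟩⟩
    exact Finset.sum_pos (fun i _ => Finset.sum_pos (fun j _ => Real.exp_pos _)
      Finset.univ_nonempty) Finset.univ_nonempty
  have hB : 0 < 1 + ((n : ℝ) - 1) * s := by
    have := mul_nonneg (sub_nonneg.2 hn1) hs0
    linarith
  have hlogS : Real.log S ≤ Real.log n + Real.log (1 + ((n : ℝ) - 1) * s) := by
    rw [← Real.log_mul hn0.ne' hB.ne']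
    exact Real.log_le_log hSpos hSle
  have hp := Real.pi_pos
  have hsp : 0 < Real.sqrt π := Real.sqrt_pos.2 hp
  have e1 : Real.log (2 * π * σ ^ 2) = Real.log 2 + Real.log π + 2 * Real.log σ := by
    rw [Real.log_mul (by positivity) (by positivity), Real.log_mul (by norm_num) hp.ne',
      Real.log_pow]
    norm_num
  have e2 : Real.log ((1 / (n : ℝ) * ((Real.sqrt π * σ) ^ d)⁻¹) ^ 2)
      = 2 * (-Real.log n - d * (Real.log π / 2 + Real.log σ)) := by
    rw [Real.log_pow, Real.log_mul (by positivity) (by positivity), Real.log_inv, Real.log_pow,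
      Real.log_mul hsp.ne' hσ.ne', Real.log_sqrt hp.le, one_div, Real.log_inv]
    push_cast
    ring
  have e3 : Real.log ((π / (2 / σ ^ 2)) ^ ((d : ℝ) / 2) * S)
      = (d : ℝ) / 2 * (Real.log π - (Real.log 2 - 2 * Real.log σ)) + Real.log S := by
    rw [Real.log_mul (by positivity) hSpos.ne', Real.log_rpow (by positivity),
      Real.log_div hp.ne' (by positivity), Real.log_div (by norm_num) (by positivity),
      Real.log_pow]
    norm_num
  rw [e1, Real.log_mul (by positivity) (by positivity), e2, e3]
  nlinarith [hlogS]
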